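/- arXiv:1609.03798 — 5 statements merged into one kernel-verified Lean document; each statement's English description precedes it below -/
import Mathlib

section
/- Fix θ > 0 and let u_n(θ) be the smallest maximizer of k ↦ L_n(θ,k) on {1,…,n}, and u_n*(θ) = θ log n − θψ(θ) − 1/2. For every L ∈ ℕ there exists n ∈ ℕ such that u_m(θ) = ⌈u_m*(θ)⌉ for all m ∈ {n, n+1, …, n+L}; and likewise for every L ∈ ℕ there exists n′ ∈ ℕ such that u_m(θ) = ⌊u_m*(θ)⌋ for all m ∈ {n′, n′+1, …, n′+L}. (There are arbitrarily long intervals of consecutive n's on which the mode is the ceiling, and arbitrarily long intervals on which it is the floor, of u_n*(θ).) -/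
open Real Filter

/-- The Ewens probability mass function with parameter `θ`. -/
noncomputable def ewensPMF (n : ℕ) (θ : ℝ) (k : ℕ) : ℝ :=
  θ ^ k * ((ascPochhammer ℕ n).coeff k : ℝ) / (ascPochhammer ℝ n).eval θ

/-- The digamma function `ψ(θ) = Γ′(θ)/Γ(θ)`, the derivative of `log ∘ Γ`. -/
noncomputable def digamma (θ : ℝ) : ℝ := deriv (fun x => Real.log (Real.Gamma x)) θ

/-- `u_n*(θ) = θ log n − θψ(θ) − 1/2`. -/
noncomputable def uStar (n : ℕ) (θ : ℝ) : ℝ := θ * Real.log n - θ * digamma θ - 1 / 2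

/-- `u` is the smallest maximizer of `k ↦ L_n(θ,k)` on `{1,…,n}`. -/
def IsLeastMode (θ : ℝ) (n u : ℕ) : Prop :=
  u ∈ Finset.Icc 1 n ∧ (∀ k ∈ Finset.Icc 1 n, ewensPMF n θ k ≤ ewensPMF n θ u) ∧
    ∀ v ∈ Finset.Icc 1 n, (∀ k ∈ Finset.Icc 1 n, ewensPMF n θ k ≤ ewensPMF n θ v) → u ≤ v

/-- The elementary symmetric sum of degree `k` of the weights `w i`, `i ∈ s`, as a coefficient
of the generating polynomial `∏ (1 + w i X)`. -/
noncomputable def weightedEsymm {ι : Type*} (w : ι → ℝ) (s : Finset ι) (k : ℕ) : ℝ :=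
  (∏ i ∈ s, (1 + Polynomial.C (w i) * Polynomial.X)).coeff k

namespace weightedEsymm

variable {ι : Type*} {w : ι → ℝ} {s : Finset ι}

lemma zero_right (w : ι → ℝ) (s : Finset ι) : weightedEsymm w s 0 = 1 := by
  simp [weightedEsymm, Polynomial.coeff_zero_eq_eval_zero, Polynomial.eval_prod]

lemma eq_zero_of_card_lt {k : ℕ} (hk : s.card < k) : weightedEsymm w s k = 0 := by
  refine Polynomial.coeff_eq_zero_of_natDegree_lt (lt_of_le_of_lt ?_ hk)
  refine (Polynomial.natDegree_prod_le _ _).trans ?_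
  refine (Finset.sum_le_card_nsmul _ _ 1 fun i _ => ?_).trans (by simp)
  compute_degree

variable [DecidableEq ι]

lemma insert_succ {i : ι} (hi : i ∉ s) (k : ℕ) :
    weightedEsymm w (insert i s) (k + 1)
      = weightedEsymm w s (k + 1) + w i * weightedEsymm w s k := by
  rw [weightedEsymm, Finset.prod_insert hi, add_mul, one_mul, mul_assoc, Polynomial.coeff_add,
    Polynomial.coeff_C_mul, Polynomial.coeff_X_mul]
  rfl

lemma succ_eq_erase {i : ι} (hi : i ∈ s) (k : ℕ) :
    weightedEsymm w s (k + 1)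
      = weightedEsymm w (s.erase i) (k + 1) + w i * weightedEsymm w (s.erase i) k := by
  conv_lhs => rw [← Finset.insert_erase hi]
  exact insert_succ (Finset.notMem_erase i s) k

lemma succ_mul_succ (w : ι → ℝ) (s : Finset ι) (k : ℕ) :
    ((k : ℝ) + 1) * weightedEsymm w s (k + 1)
      = ∑ i ∈ s, w i * weightedEsymm w (s.erase i) k := by
  have h := congrArg (fun p => Polynomial.coeff p k)
    (Polynomial.derivative_prod_finset (s := s)
      (f := fun i => (1 + Polynomial.C (w i) * Polynomial.X : Polynomial ℝ)))
  simp only [Polynomial.coeff_derivative, Polynomial.finsetSum_coeff, Polynomial.derivative_add,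
    Polynomial.derivative_one, Polynomial.derivative_C_mul, Polynomial.derivative_X, zero_add,
    mul_one, Polynomial.coeff_mul_C] at h
  rw [mul_comm, weightedEsymm, h]
  exact Finset.sum_congr rfl fun i _ => mul_comm _ _

lemma nonneg (hw : ∀ i, 0 ≤ w i) (s : Finset ι) (k : ℕ) : 0 ≤ weightedEsymm w s k := by
  induction s using Finset.induction_on generalizing k with
  | empty =>
    rw [weightedEsymm, Finset.prod_empty, Polynomial.coeff_one]
    split_ifs <;> norm_num
  | insert i s hi ih =>
    cases k with
    | zero => rw [zero_right]; exact zero_le_one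
    | succ k =>
      rw [insert_succ hi]
      exact add_nonneg (ih _) (mul_nonneg (hw i) (ih _))

lemma erase_le (hw : ∀ i, 0 ≤ w i) {i : ι} (hi : i ∈ s) (k : ℕ) :
    weightedEsymm w (s.erase i) k ≤ weightedEsymm w s k := by
  cases k with
  | zero => simp only [zero_right, le_refl]
  | succ k =>
    rw [succ_eq_erase hi]
    exact le_add_of_nonneg_right (mul_nonneg (hw i) (nonneg hw _ _))

lemma succ_mul_succ_le (hw : ∀ i, 0 ≤ w i) (s : Finset ι) (k : ℕ) :
    ((k : ℝ) + 1) * weightedEsymm w s (k + 1) ≤ (∑ i ∈ s, w i) * weightedEsymm w s k := by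
  rw [succ_mul_succ, Finset.sum_mul]
  exact Finset.sum_le_sum fun i hi => mul_le_mul_of_nonneg_left (erase_le hw hi k) (hw i)

lemma le_succ_mul_succ (hw : ∀ i, 0 ≤ w i) (s : Finset ι) (k : ℕ) :
    (∑ i ∈ s, w i) * weightedEsymm w s (k + 1) - (∑ i ∈ s, w i ^ 2) * weightedEsymm w s k
      ≤ ((k : ℝ) + 2) * weightedEsymm w s (k + 2) := by
  have h := succ_mul_succ w s (k + 1)
  push_cast at h
  rw [show (k : ℝ) + 2 = k + 1 + 1 by ring, h, Finset.sum_mul, Finset.sum_mul,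
    ← Finset.sum_sub_distrib]
  refine Finset.sum_le_sum fun i hi => ?_
  rw [succ_eq_erase hi]
  nlinarith [mul_le_mul_of_nonneg_left (erase_le hw hi k) (sq_nonneg (w i))]

lemma pos_and_le_two_mul_succ (hw : ∀ i, 0 ≤ w i) (s : Finset ι) (k : ℕ)
    (hk : (k : ℝ) + 1 ≤ 2 * (∑ i ∈ s, w i - 2 * ∑ i ∈ s, w i ^ 2)) :
    0 < weightedEsymm w s k ∧
      (∑ i ∈ s, w i - 2 * ∑ i ∈ s, w i ^ 2) * weightedEsymm w s k
        ≤ ((k : ℝ) + 1) * weightedEsymm w s (k + 1) ∧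
      weightedEsymm w s k ≤ 2 * weightedEsymm w s (k + 1) := by
  have hQ : 0 ≤ ∑ i ∈ s, w i ^ 2 := Finset.sum_nonneg fun i _ => sq_nonneg (w i)
  induction k with
  | zero =>
    have h := succ_mul_succ w s 0
    simp only [zero_right, mul_one, Nat.cast_zero, zero_add, one_mul] at h hk ⊢
    rw [h]
    refine ⟨one_pos, ?_, ?_⟩ <;> linarith
  | succ k ih =>
    push_cast at hk
    obtain ⟨h0, -, h2⟩ := ih (by linarith)
    have hpos : 0 < weightedEsymm w s (k + 1) := by linarith
    have hlow := le_succ_mul_succ hw s k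
    have hmul := mul_le_mul_of_nonneg_left h2 hQ
    have key : (∑ i ∈ s, w i - 2 * ∑ i ∈ s, w i ^ 2) * weightedEsymm w s (k + 1)
        ≤ ((k : ℝ) + 2) * weightedEsymm w s (k + 2) := by linarith
    refine ⟨hpos, ?_, ?_⟩
    · push_cast
      rw [show (k : ℝ) + 1 + 1 = k + 2 by ring]
      exact key
    · have h3 := mul_le_mul_of_nonneg_right hk hpos.le
      have hk2 : (0 : ℝ) < k + 2 := by positivity
      refine le_of_mul_le_mul_left ?_ hk2
      rw [show k + 1 + 1 = k + 2 by ring] at *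
      linarith

/-- The ratio of consecutive elementary symmetric sums, at degree close to the mean
`M = ∑ w i / (1 + w i)`, is `M / (k + 2)` up to a small error. -/
lemma abs_sub_mean_mul_le (hw : ∀ i, 0 ≤ w i) {B : ℝ} (hB : ∀ i, w i ≤ B)
    (hQ : ∑ i ∈ s, w i ^ 2 ≤ B) (k : ℕ) (hk : (k : ℝ) + 1 ≤ 2 * (∑ i ∈ s, w i - 3 * B)) :
    |((k : ℝ) + 2) * weightedEsymm w s (k + 2)
        - (∑ i ∈ s, w i / (1 + w i)) * weightedEsymm w s (k + 1)|
      ≤ B * ((|∑ i ∈ s, w i - (k + 1)| + 3 * B) * (2 * weightedEsymm w s (k + 1)) / (k + 1)) := by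
  set W := ∑ i ∈ s, w i with hW
  set R := (|W - (k + 1)| + 3 * B) * (2 * weightedEsymm w s (k + 1)) / (k + 1) with hR
  have hB0 : 0 ≤ B := (Finset.sum_nonneg fun i _ => sq_nonneg (w i)).trans hQ
  have hk1 : (0 : ℝ) < k + 1 := by positivity
  have hR0 : 0 ≤ R := by
    have := nonneg hw s (k + 1)
    positivity
  have hdelta : ∀ i ∈ s,
      |weightedEsymm w (s.erase i) (k + 1) - weightedEsymm w (s.erase i) k| ≤ R := by
    intro i hi
    have hWi : ∑ j ∈ s.erase i, w j = W - w i := by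
      rw [hW, ← Finset.add_sum_erase s w hi]; ring
    have hQi : ∑ j ∈ s.erase i, w j ^ 2 ≤ B :=
      (Finset.sum_le_sum_of_subset_of_nonneg (Finset.erase_subset i s)
        fun j _ _ => sq_nonneg (w j)).trans hQ
    have hup := succ_mul_succ_le hw (s.erase i) k
    have hlo := (pos_and_le_two_mul_succ hw (s.erase i) k (by rw [hWi]; linarith [hB i])).2.1
    have hs := (pos_and_le_two_mul_succ hw s k (by linarith)).2.2
    rw [hWi] at hup hlo
    have he := nonneg hw (s.erase i) k
    have hle := (erase_le hw hi k).trans hs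
    have hbd : |((k : ℝ) + 1) *
        (weightedEsymm w (s.erase i) (k + 1) - weightedEsymm w (s.erase i) k)|
        ≤ (|W - (k + 1)| + 3 * B) * weightedEsymm w (s.erase i) k := by
      have ha := mul_le_mul_of_nonneg_right (le_abs_self (W - (k + 1))) he
      have hb := mul_le_mul_of_nonneg_right (neg_abs_le (W - (k + 1))) he
      have hc := mul_le_mul_of_nonneg_right (hB i) he
      have hd := mul_le_mul_of_nonneg_right hQi he
      have hf := mul_nonneg (hw i) he
      have hg := mul_nonneg hB0 he
      rw [abs_le]
      constructor <;> linarith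
    rw [hR, le_div_iff₀ hk1]
    rw [abs_mul, abs_of_pos hk1] at hbd
    have := mul_le_mul_of_nonneg_left hle (by positivity : 0 ≤ |W - (k + 1)| + 3 * B)
    linarith
  have hid : ((k : ℝ) + 2) * weightedEsymm w s (k + 2)
        - (∑ i ∈ s, w i / (1 + w i)) * weightedEsymm w s (k + 1)
      = ∑ i ∈ s, w i ^ 2 / (1 + w i) *
          (weightedEsymm w (s.erase i) (k + 1) - weightedEsymm w (s.erase i) k) := by
    have h := succ_mul_succ w s (k + 1)
    push_cast at h
    rw [show (k : ℝ) + 2 = k + 1 + 1 by ring, h, Finset.sum_mul, ← Finset.sum_sub_distrib]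
    refine Finset.sum_congr rfl fun i hi => ?_
    have : 1 + w i ≠ 0 := by linarith [hw i]
    rw [succ_eq_erase hi]
    field_simp
    ring
  rw [hid]
  refine (Finset.abs_sum_le_sum_abs _ _).trans ?_
  refine le_trans ?_ (mul_le_mul_of_nonneg_right hQ hR0)
  rw [Finset.sum_mul]
  refine Finset.sum_le_sum fun i hi => ?_
  have h1 : 0 ≤ w i ^ 2 / (1 + w i) := div_nonneg (sq_nonneg _) (by linarith [hw i])
  rw [abs_mul, abs_of_nonneg h1]
  refine mul_le_mul ?_ (hdelta i hi) (abs_nonneg _) (sq_nonneg _)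
  exact div_le_self (sq_nonneg _) (by linarith [hw i])

/-- When the mean `M = ∑ w i / (1 + w i)` is large, the elementary symmetric sums increase
strictly up to degree `M` and decrease from there on, up to an error of `1 / 10`. -/
lemma exists_forall_mean_monotone (B : ℝ) (hB : 0 ≤ B) :
    ∃ M₀ : ℝ, ∀ (w : ι → ℝ) (s : Finset ι), (∀ i, 0 ≤ w i) → (∀ i, w i ≤ B) →
      ∑ i ∈ s, w i ^ 2 ≤ B → M₀ ≤ ∑ i ∈ s, w i / (1 + w i) → ∀ k : ℕ,
        ((k : ℝ) + 1 < ∑ i ∈ s, w i / (1 + w i) - 1 / 10 →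
          weightedEsymm w s k < weightedEsymm w s (k + 1)) ∧
        (∑ i ∈ s, w i / (1 + w i) + 1 / 10 ≤ (k : ℝ) + 1 →
          weightedEsymm w s (k + 1) ≤ weightedEsymm w s k) := by
  refine ⟨20 * B * (6 * B + 2) + 8 * B + 10, fun w s hw hwB hQ hM k => ?_⟩
  set M := ∑ i ∈ s, w i / (1 + w i) with hMdef
  set W := ∑ i ∈ s, w i with hWdef
  have hWM : M ≤ W ∧ W ≤ M + B := by
    constructor
    · exact Finset.sum_le_sum fun i _ => div_le_self (hw i) (by linarith [hw i])
    · refine le_trans ?_ (add_le_add_right hQ M)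
      rw [hMdef, hWdef, ← Finset.sum_add_distrib]
      refine Finset.sum_le_sum fun i _ => ?_
      have h1 : 0 < 1 + w i := by linarith [hw i]
      rw [← sub_nonneg, show w i / (1 + w i) + w i ^ 2 - w i = w i ^ 3 / (1 + w i) by
        field_simp; ring]
      have := hw i
      positivity
  have hk1 : (0 : ℝ) < k + 1 := by positivity
  have hBB : 0 ≤ B * (6 * B + 2) := by positivity
  have he := nonneg hw s k
  rcases lt_or_ge ((k : ℝ) + 1) (M - 2 * B) with hlt | hge
  · refine ⟨fun _ => ?_, fun h => by linarith⟩
    obtain ⟨hpos, hlow, -⟩ := pos_and_le_two_mul_succ hw s k (by linarith)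
    refine lt_of_mul_lt_mul_left ?_ hk1.le
    refine lt_of_lt_of_le (mul_lt_mul_of_pos_right ?_ hpos) hlow
    linarith
  rcases le_or_gt (M + B) ((k : ℝ) + 1) with hbig | hsmall
  · refine ⟨fun h => by linarith, fun _ => ?_⟩
    refine le_of_mul_le_mul_left ((succ_mul_succ_le hw s k).trans ?_) hk1
    exact mul_le_mul_of_nonneg_right (by linarith) he
  obtain ⟨j, rfl⟩ : ∃ j, k = j + 1 := Nat.exists_eq_succ_of_ne_zero (by
    rintro rfl
    push_cast at hge
    linarith)
  push_cast at *
  have hpos := (pos_and_le_two_mul_succ hw s (j + 1) (by push_cast; linarith)).1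
  have hmain := abs_sub_mean_mul_le hw hwB hQ j (by linarith)
  have habs : |W - ((j : ℝ) + 1)| ≤ 3 * B + 2 := by
    rw [abs_le]
    constructor <;> linarith
  have hj1 : (0 : ℝ) < j + 1 := by positivity
  have herr : B * ((|W - ((j : ℝ) + 1)| + 3 * B) * (2 * weightedEsymm w s (j + 1)) / (j + 1))
      ≤ 1 / 10 * weightedEsymm w s (j + 1) := by
    rw [← mul_div_assoc, div_le_iff₀ hj1]
    have h1 : B * (|W - ((j : ℝ) + 1)| + 3 * B) * 2 ≤ 1 / 10 * (j + 1) := by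
      have := mul_le_mul_of_nonneg_left
        (by linarith : |W - ((j : ℝ) + 1)| + 3 * B ≤ 6 * B + 2) hB
      linarith
    have := mul_le_mul_of_nonneg_right h1 hpos.le
    linarith
  obtain ⟨hl, hu⟩ := abs_le.mp (hmain.trans herr)
  have hj2 : (0 : ℝ) < j + 2 := by positivity
  constructor
  · intro h
    refine lt_of_mul_lt_mul_left ?_ hj2.le
    have := mul_lt_mul_of_pos_right h hpos
    linarith
  · intro h
    refine le_of_mul_le_mul_left ?_ hj2
    have := mul_le_mul_of_nonneg_right h hpos.le
    linarith

end weightedEsymm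

lemma ewensPMF_succ_succ (θ : ℝ) (N k : ℕ) :
    ewensPMF (N + 1) θ (k + 1)
      = θ * N.factorial / (ascPochhammer ℝ (N + 1)).eval θ *
          weightedEsymm (fun i : ℕ => θ / (i + 1)) (Finset.range N) k := by
  have key : ∀ N k : ℕ, θ ^ k * ((ascPochhammer ℕ (N + 1)).coeff (k + 1) : ℝ)
      = N.factorial * weightedEsymm (fun i : ℕ => θ / (i + 1)) (Finset.range N) k := by
    intro N
    induction N with
    | zero =>
      intro k
      rcases k with - | k <;> simp [weightedEsymm, Polynomial.coeff_X, Polynomial.coeff_one]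
    | succ N ih =>
      intro k
      have hN : (N : ℝ) + 1 ≠ 0 := by positivity
      rw [ascPochhammer_succ_right, mul_add, Polynomial.coeff_add, Polynomial.coeff_mul_X,
        Polynomial.coeff_mul_natCast, Nat.factorial_succ, Finset.range_add_one]
      rcases k with - | k
      · have h := ih 0
        have h0 : (ascPochhammer ℕ (N + 1)).coeff 0 = 0 := by
          simp [Polynomial.coeff_zero_eq_eval_zero]
        simp only [weightedEsymm.zero_right, h0] at h ⊢
        push_cast at h ⊢
        linear_combination ((N : ℝ) + 1) * h
      · rw [weightedEsymm.insert_succ Finset.notMem_range_self]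
        push_cast
        have h1 := ih k
        have h2 := ih (k + 1)
        have h3 : ((N : ℝ) + 1) * (θ / (N + 1)) = θ := by field_simp
        linear_combination θ * h1 + ((N : ℝ) + 1) * h2
          - N.factorial * weightedEsymm (fun i : ℕ => θ / (i + 1)) (Finset.range N) k * h3
  rw [ewensPMF, pow_succ]
  linear_combination θ / (ascPochhammer ℝ (N + 1)).eval θ * key N k

lemma IsLeastMode.eq_of_monotone {θ : ℝ} (hθ : 0 < θ) {N u K : ℕ} (hu : IsLeastMode θ (N + 1) u)
    (hlt : ∀ k < K, weightedEsymm (fun i : ℕ => θ / (i + 1)) (Finset.range N) k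
      < weightedEsymm (fun i : ℕ => θ / (i + 1)) (Finset.range N) (k + 1))
    (hge : ∀ k ≥ K, weightedEsymm (fun i : ℕ => θ / (i + 1)) (Finset.range N) (k + 1)
      ≤ weightedEsymm (fun i : ℕ => θ / (i + 1)) (Finset.range N) k) :
    u = K + 1 := by
  set e := weightedEsymm (fun i : ℕ => θ / (i + 1)) (Finset.range N) with he
  have hc : 0 < θ * N.factorial / (ascPochhammer ℝ (N + 1)).eval θ := by
    have := ascPochhammer_pos (N + 1) θ hθ
    positivity
  have hlt' : ∀ d k, k + d + 1 = K → e k < e K := by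
    intro d
    induction d with
    | zero => rintro k rfl; exact hlt k (by omega)
    | succ d ih => exact fun k hk => (hlt k (by omega)).trans (ih (k + 1) (by omega))
  have hge' : ∀ k ≥ K, e k ≤ e K := by
    intro k hk
    induction k, hk using Nat.le_induction with
    | base => exact le_rfl
    | succ k hk ih => exact (hge k hk).trans ih
  have hmax : ∀ k, e k ≤ e K := fun k => by
    rcases lt_or_ge k K with h | h
    · exact (hlt' (K - k - 1) k (by omega)).le
    · exact hge' k h
  have hKN : K ≤ N := by
    by_contra! h
    have h0 : e K = 0 := weightedEsymm.eq_zero_of_card_lt (by simpa using h)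
    have h1 := hmax 0
    rw [h0, he, weightedEsymm.zero_right] at h1
    linarith
  obtain ⟨hmem, hle, hleast⟩ := hu
  obtain ⟨v, rfl⟩ : ∃ v, u = v + 1 :=
    Nat.exists_eq_succ_of_ne_zero (by have := (Finset.mem_Icc.mp hmem).1; omega)
  refine le_antisymm (hleast _ (Finset.mem_Icc.mpr ⟨by omega, by omega⟩) ?_) ?_
  · intro k hk
    obtain ⟨j, rfl⟩ : ∃ j, k = j + 1 :=
      Nat.exists_eq_succ_of_ne_zero (by have := (Finset.mem_Icc.mp hk).1; omega)
    rw [ewensPMF_succ_succ, ewensPMF_succ_succ]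
    exact mul_le_mul_of_nonneg_left (hmax j) hc.le
  · by_contra! h
    have h1 := hle (K + 1) (Finset.mem_Icc.mpr ⟨by omega, by omega⟩)
    rw [ewensPMF_succ_succ, ewensPMF_succ_succ] at h1
    exact absurd (le_of_mul_le_mul_left h1 hc) (not_le.mpr (hlt' (K - v - 1) v (by omega)))

lemma differentiableAt_log_Gamma {x : ℝ} (hx : 0 < x) :
    DifferentiableAt ℝ (fun x => Real.log (Real.Gamma x)) x := by
  refine (Real.differentiableAt_Gamma fun m => ?_).log (Real.Gamma_pos_of_pos hx).ne'
  have : (0 : ℝ) ≤ m := m.cast_nonneg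
  linarith

lemma log_Gamma_add_one {x : ℝ} (hx : 0 < x) :
    Real.log (Real.Gamma (x + 1)) = Real.log (Real.Gamma x) + Real.log x := by
  rw [Real.Gamma_add_one hx.ne', Real.log_mul hx.ne' (Real.Gamma_pos_of_pos hx).ne', add_comm]

lemma digamma_add_one {x : ℝ} (hx : 0 < x) : digamma (x + 1) = digamma x + 1 / x := by
  rw [digamma, digamma, ← deriv_comp_add_const, one_div, ← Real.deriv_log,
    ← deriv_fun_add (differentiableAt_log_Gamma hx) (Real.differentiableAt_log hx.ne')]
  refine EventuallyEq.deriv_eq ?_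
  filter_upwards [eventually_gt_nhds hx] with y hy using log_Gamma_add_one hy

lemma digamma_add_natCast {x : ℝ} (hx : 0 < x) (n : ℕ) :
    digamma (x + n) = digamma x + ∑ i ∈ Finset.range n, 1 / (x + i) := by
  induction n with
  | zero => simp
  | succ n ih =>
    rw [Finset.sum_range_succ, ← add_assoc, ← ih, ← digamma_add_one (by positivity)]
    push_cast
    rw [add_assoc]

lemma digamma_le_log {x : ℝ} (hx : 0 < x) : digamma x ≤ Real.log x := by
  refine (Real.convexOn_log_Gamma.deriv_le_slope (Set.mem_Ioi.mpr hx)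
    (Set.mem_Ioi.mpr (by linarith : 0 < x + 1)) (by linarith)
    (differentiableAt_log_Gamma hx)).trans (le_of_eq ?_)
  rw [slope_def_field, Function.comp_apply, Function.comp_apply, log_Gamma_add_one hx]
  ring

lemma log_le_digamma_add_one {x : ℝ} (hx : 0 < x) : Real.log x ≤ digamma (x + 1) := by
  refine (le_of_eq ?_).trans (Real.convexOn_log_Gamma.slope_le_deriv (Set.mem_Ioi.mpr hx)
    (Set.mem_Ioi.mpr (by linarith : 0 < x + 1)) (by linarith)
    (differentiableAt_log_Gamma (by linarith)))
  rw [slope_def_field, Function.comp_apply, Function.comp_apply, log_Gamma_add_one hx]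
  ring

lemma tendsto_digamma_add_sub_log (a : ℝ) :
    Tendsto (fun x : ℝ => digamma (x + a) - Real.log x) atTop (nhds 0) := by
  refine tendsto_of_tendsto_of_tendsto_of_le_of_le'
    (Real.tendsto_log_comp_add_sub_log (a - 1)) (Real.tendsto_log_comp_add_sub_log a) ?_ ?_
  · filter_upwards [eventually_gt_atTop (1 - a)] with x hx
    have h := log_le_digamma_add_one (x := x + (a - 1)) (by linarith)
    rw [show x + (a - 1) + 1 = x + a by ring] at h
    linarith
  · filter_upwards [eventually_gt_atTop (-a)] with x hx
    have h := digamma_le_log (x := x + a) (by linarith)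
    linarith

lemma sum_mean_eq_digamma {θ : ℝ} (hθ : 0 < θ) (N : ℕ) :
    ∑ i ∈ Finset.range N, θ / (i + 1) / (1 + θ / ((i : ℝ) + 1))
      = θ * (digamma (((N + 1 : ℕ) : ℝ) + θ) - digamma θ) - 1 := by
  rw [add_comm _ θ, digamma_add_natCast hθ, Finset.sum_range_succ', add_sub_cancel_left, mul_add,
    Finset.mul_sum, Nat.cast_zero, add_zero, mul_one_div_cancel hθ.ne', add_sub_cancel_right]
  refine Finset.sum_congr rfl fun i _ => ?_
  push_cast
  field_simp
  ring

/-- For large `n`, the mode is the integer nearest to `u_n*(θ)`, unless `u_n*(θ)` is close to a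
half-integer. -/
lemma exists_forall_mode_eq {θ : ℝ} (hθ : 0 < θ) :
    ∃ N : ℕ, ∀ n ≥ N, ∀ u, IsLeastMode θ n u → ∀ K : ℕ,
      (K : ℝ) + 7 / 10 < uStar n θ → uStar n θ < (K : ℝ) + 13 / 10 → u = K + 1 := by
  set w : ℕ → ℝ := fun i => θ / (i + 1) with hw
  have hw0 : ∀ i, 0 ≤ w i := fun i => by simp only [hw]; positivity
  have hwθ : ∀ i, w i ≤ θ := fun i => div_le_self hθ.le (by simp)
  have hsum : Summable fun i => w i ^ 2 := by
    have h := (summable_nat_add_iff 1).mpr (Real.summable_one_div_nat_pow.mpr one_lt_two)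
    refine (h.mul_left (θ ^ 2)).congr fun i => ?_
    simp only [hw]
    push_cast
    rw [div_pow, mul_one_div]
  have hB0 : 0 ≤ ∑' i, w i ^ 2 := tsum_nonneg fun i => sq_nonneg (w i)
  obtain ⟨M₀, hM₀⟩ := weightedEsymm.exists_forall_mean_monotone (ι := ℕ)
    (θ + ∑' i, w i ^ 2) (by positivity)
  have hlim := ((tendsto_digamma_add_sub_log θ).const_mul θ).comp tendsto_natCast_atTop_atTop
  rw [mul_zero] at hlim
  have hlog : Tendsto (fun n : ℕ => θ * Real.log n) atTop atTop :=
    (Real.tendsto_log_atTop.comp tendsto_natCast_atTop_atTop).const_mul_atTop hθ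
  obtain ⟨N, hN⟩ := eventually_atTop.mp
    (((hlim.eventually_const_lt (by norm_num : -(1 / 10 : ℝ) < 0)).and
      (hlim.eventually_lt_const (by norm_num : (0 : ℝ) < 1 / 10))).and
      ((hlog.eventually_ge_atTop (M₀ + θ * digamma θ + 2)).and (eventually_ge_atTop 1)))
  refine ⟨N, fun n hn u hu K hK1 hK2 => ?_⟩
  obtain ⟨⟨hl, hr⟩, hlogn, hn1⟩ := hN n hn
  obtain ⟨m, rfl⟩ := Nat.exists_eq_succ_of_ne_zero (by omega : n ≠ 0)
  simp only [Function.comp_apply, Nat.succ_eq_add_one] at *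
  have hmean := sum_mean_eq_digamma hθ m
  rw [uStar] at hK1 hK2
  have key := hM₀ w (Finset.range m) hw0 (fun i => (hwθ i).trans (by linarith))
    ((hsum.sum_le_tsum _ fun i _ => sq_nonneg (w i)).trans (by linarith))
    (by linarith)
  refine hu.eq_of_monotone hθ (fun k hk => (key k).1 ?_) (fun k hk => (key k).2 ?_)
  · have : (k : ℝ) + 1 ≤ K := by exact_mod_cast hk
    linarith
  · have : (K : ℝ) ≤ k := by exact_mod_cast hk
    linarith

/-- The slowly growing sequence `u_n*(θ)` has arbitrarily long runs in any interval modulo `1`. -/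
lemma exists_run_uStar {θ : ℝ} (hθ : 0 < θ) {a b : ℝ} (hab : a < b) (N L : ℕ) :
    ∃ n ≥ N, ∃ K : ℕ, ∀ m ∈ Finset.Icc n (n + L), (K : ℝ) + a < uStar m θ ∧
      uStar m θ < (K : ℝ) + b := by
  have hlin : Tendsto (fun K : ℕ => ((K : ℝ) + (a + θ * digamma θ + 1 / 2)) / θ) atTop atTop :=
    (tendsto_atTop_add_const_right _ _ tendsto_natCast_atTop_atTop).atTop_div_const hθ
  have hexp := Real.tendsto_exp_atTop.comp hlin
  obtain ⟨K, hK1, hK2⟩ := ((hexp.eventually_ge_atTop (N : ℝ)).and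
    (hexp.eventually_gt_atTop (θ * (L + 2) / (b - a)))).exists
  simp only [Function.comp_apply] at hK1 hK2
  set y := ((K : ℝ) + (a + θ * digamma θ + 1 / 2)) / θ with hy
  have hyθ : θ * y = K + (a + θ * digamma θ + 1 / 2) := by rw [hy]; field_simp
  have hx : 0 < Real.exp y := Real.exp_pos y
  have hfl : Real.exp y < ⌊Real.exp y⌋₊ + 1 := Nat.lt_floor_add_one _
  refine ⟨⌊Real.exp y⌋₊ + 1, ?_, K, fun m hm => ?_⟩
  · have : (N : ℝ) < ⌊Real.exp y⌋₊ + 1 := by linarith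
    exact_mod_cast this.le
  obtain ⟨hm1, hm2⟩ := Finset.mem_Icc.mp hm
  have hm1' : (⌊Real.exp y⌋₊ : ℝ) + 1 ≤ m := by exact_mod_cast hm1
  have hm2' : (m : ℝ) ≤ ⌊Real.exp y⌋₊ + 1 + L := by exact_mod_cast hm2
  have hflo := Nat.floor_le hx.le
  have hm0 : (0 : ℝ) < m := by linarith
  have hlow : y < Real.log m := (Real.lt_log_iff_exp_lt hm0).mpr (by linarith)
  have hup : Real.log m ≤ y + (L + 2) / Real.exp y := by
    have h1 : Real.log (m / Real.exp y) ≤ m / Real.exp y - 1 :=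
      Real.log_le_sub_one_of_pos (by positivity)
    rw [Real.log_div hm0.ne' hx.ne', Real.log_exp] at h1
    have h2 : (m : ℝ) / Real.exp y - 1 ≤ (L + 2) / Real.exp y := by
      rw [div_sub_one hx.ne']
      exact div_le_div_of_nonneg_right (by linarith) hx.le
    linarith
  have hsmall : θ * ((L + 2) / Real.exp y) < b - a := by
    rw [← mul_div_assoc, div_lt_iff₀ hx, mul_comm (b - a)]
    exact (div_lt_iff₀ (by linarith)).mp hK2
  have h1 := mul_lt_mul_of_pos_left hlow hθ
  have h2 := mul_le_mul_of_nonneg_left hup hθ.le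
  rw [uStar]
  constructor <;> linarith

/-- There are arbitrarily long intervals of consecutive `n`'s on which the mode is the
ceiling of `u_n*(θ)`, and arbitrarily long intervals on which it is the floor. -/
theorem ewens_mode_long_runs (θ : ℝ) (hθ : 0 < θ) (u : ℕ → ℕ)
    (hu : ∀ n ≥ 1, IsLeastMode θ n (u n)) :
    (∀ L : ℕ, ∃ n : ℕ, ∀ m ∈ Finset.Icc n (n + L), (u m : ℤ) = ⌈uStar m θ⌉) ∧
    (∀ L : ℕ, ∃ n' : ℕ, ∀ m ∈ Finset.Icc n' (n' + L), (u m : ℤ) = ⌊uStar m θ⌋) := by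
  obtain ⟨N, hN⟩ := exists_forall_mode_eq hθ
  constructor <;> intro L
  · obtain ⟨n, hn, K, hK⟩ := exists_run_uStar hθ (by norm_num : (8 / 10 : ℝ) < 9 / 10) (N + 1) L
    refine ⟨n, fun m hm => ?_⟩
    obtain ⟨h1, h2⟩ := hK m hm
    have hnm := (Finset.mem_Icc.mp hm).1
    rw [hN m (by omega) (u m) (hu m (by omega)) K (by linarith) (by linarith), eq_comm,
      Int.ceil_eq_iff]
    push_cast
    constructor <;> linarith
  · obtain ⟨n, hn, K, hK⟩ := exists_run_uStar hθ (by norm_num : (11 / 10 : ℝ) < 12 / 10) (N + 1) L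
    refine ⟨n, fun m hm => ?_⟩
    obtain ⟨h1, h2⟩ := hK m hm
    have hnm := (Finset.mem_Icc.mp hm).1
    rw [hN m (by omega) (u m) (hu m (by omega)) K (by linarith) (by linarith), eq_comm,
      Int.floor_eq_iff]
    push_cast
    constructor <;> linarith
end

section
/- For every α > 0, β ∈ ℝ, and δ > 0 there exists ε > 0 such that limsup_{n→∞} (1/n) · #{ k ∈ {1,…,n} : ∃ j ∈ ℤ, |log k − (α j + β)| < ε } < δ. (The asymptotic upper density of the set of k whose logarithm lies within ε of the arithmetic progression αℤ + β tends to 0 as ε → 0.) -/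
open Real Filter

/-- At most `n (e^{2ε} - 1) + 1` of the integers in `[1, n]` have logarithm within `ε` of `c`. -/
lemma card_abs_log_sub_lt_le (c ε : ℝ) (hε : 0 < ε) (n : ℕ) :
    (((Finset.Icc 1 n).filter fun k : ℕ => |Real.log k - c| < ε).card : ℝ)
      ≤ n * (Real.exp (2 * ε) - 1) + 1 := by
  have he : 1 ≤ Real.exp (2 * ε) := Real.one_le_exp (by linarith)
  set s := (Finset.Icc 1 n).filter fun k : ℕ => |Real.log k - c| < ε with hs
  rcases s.eq_empty_or_nonempty with h | h
  · rw [h]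
    simp only [Finset.card_empty, Nat.cast_zero]
    have : 0 ≤ (n : ℝ) * (Real.exp (2 * ε) - 1) := mul_nonneg n.cast_nonneg (by linarith)
    linarith
  · set m := s.min' h with hm
    have hms : m ∈ s := s.min'_mem h
    simp only [hs, Finset.mem_filter, Finset.mem_Icc] at hms
    obtain ⟨⟨hm1, hmn⟩, hmc⟩ := hms
    have hm0 : (0 : ℝ) < m := by exact_mod_cast hm1
    have hmn' : (m : ℝ) ≤ n := by exact_mod_cast hmn
    have hsub : s ⊆ Finset.Icc m ⌊(m : ℝ) * Real.exp (2 * ε)⌋₊ := by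
      intro k hk
      have hmk : m ≤ k := s.min'_le k hk
      simp only [hs, Finset.mem_filter, Finset.mem_Icc] at hk
      obtain ⟨⟨hk1, -⟩, hkc⟩ := hk
      have hk0 : (0 : ℝ) < k := by exact_mod_cast hk1
      refine Finset.mem_Icc.2 ⟨hmk, Nat.le_floor ?_⟩
      rw [abs_lt] at hmc hkc
      rw [← Real.log_le_log_iff hk0 (by positivity), Real.log_mul hm0.ne' (Real.exp_ne_zero _),
        Real.log_exp]
      linarith
    have hle : m ≤ ⌊(m : ℝ) * Real.exp (2 * ε)⌋₊ :=
      Nat.le_floor (le_mul_of_one_le_right hm0.le he)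
    have hcard := Finset.card_le_card hsub
    rw [Nat.card_Icc] at hcard
    have hcard' : s.card + m ≤ ⌊(m : ℝ) * Real.exp (2 * ε)⌋₊ + 1 := by omega
    have hfl : (⌊(m : ℝ) * Real.exp (2 * ε)⌋₊ : ℝ) ≤ m * Real.exp (2 * ε) :=
      Nat.floor_le (by positivity)
    have hcast : (s.card : ℝ) + m ≤ ⌊(m : ℝ) * Real.exp (2 * ε)⌋₊ + 1 := by exact_mod_cast hcard'
    have := mul_le_mul_of_nonneg_right hmn' (by linarith : 0 ≤ Real.exp (2 * ε) - 1)
    linarith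

lemma Int.card_Icc_ceil_floor_le {a b : ℝ} (hab : a ≤ b) :
    ((Finset.Icc ⌈a⌉ ⌊b⌋).card : ℝ) ≤ b - a + 1 := by
  rw [Int.card_Icc, ← Int.cast_natCast, Int.toNat_eq_max]
  push_cast
  have := Int.le_ceil a
  have := Int.floor_le b
  exact max_le (by linarith) (by linarith)

/-- A bound for the number of integers in `[1, n]` with logarithm near `αℤ + β`: those below `η n`
are counted trivially, the others are near boundedly many terms of the progression. -/
lemma ncard_log_near_arithmetic_progression_le (α β η ε : ℝ) (hα : 0 < α) (hη : 0 < η)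
    (hη1 : η ≤ 1) (hε : 0 < ε) (n : ℕ) (hn : 0 < n) :
    (Set.ncard {k : ℕ | k ∈ Finset.Icc 1 n ∧
        ∃ j : ℤ, |Real.log k - (α * j + β)| < ε} : ℝ)
      ≤ η * n + ((2 * ε - Real.log η) / α + 1) * (n * (Real.exp (2 * ε) - 1) + 1) := by
  have hn0 : (0 : ℝ) < n := by exact_mod_cast hn
  have hlη : Real.log η ≤ 0 := Real.log_nonpos hη.le hη1
  set a := (Real.log n + Real.log η - β - ε) / α with ha
  set b := (Real.log n - β + ε) / α with hb
  have hab : a ≤ b := by rw [ha, hb]; gcongr; linarith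
  have hba : b - a = (2 * ε - Real.log η) / α := by rw [ha, hb]; ring
  set J := Finset.Icc ⌈a⌉ ⌊b⌋ with hJ
  set T : ℤ → Finset ℕ := fun j =>
    (Finset.Icc 1 n).filter fun k : ℕ => |Real.log k - (α * j + β)| < ε with hT
  have hsub : {k : ℕ | k ∈ Finset.Icc 1 n ∧ ∃ j : ℤ, |Real.log k - (α * j + β)| < ε} ⊆
      ((Finset.Icc 1 ⌊η * n⌋₊ ∪ J.biUnion T : Finset ℕ) : Set ℕ) := by
    rintro k ⟨hk, j, hj⟩
    rw [Finset.mem_coe, Finset.mem_union]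
    have hk' := Finset.mem_Icc.1 hk
    have hk0 : (0 : ℝ) < k := by exact_mod_cast hk'.1
    rcases le_or_gt (k : ℝ) (η * n) with h | h
    · exact Or.inl (Finset.mem_Icc.2 ⟨hk'.1, Nat.le_floor h⟩)
    · refine Or.inr (Finset.mem_biUnion.2 ⟨j, ?_, Finset.mem_filter.2 ⟨hk, hj⟩⟩)
      have h1 := Real.log_lt_log (by positivity) h
      rw [Real.log_mul hη.ne' hn0.ne'] at h1
      have h2 : Real.log k ≤ Real.log n := Real.log_le_log hk0 (by exact_mod_cast hk'.2)
      rw [abs_lt] at hj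
      rw [hJ, Finset.mem_Icc, Int.ceil_le, Int.le_floor, ha, hb, div_le_iff₀ hα, le_div_iff₀ hα]
      constructor <;> linarith
  have hcard := (Set.ncard_le_ncard hsub (Finset.finite_toSet _)).trans_eq (Set.ncard_coe_finset _)
  have hunion := (hcard.trans (Finset.card_union_le _ _)).trans
    (Nat.add_le_add_left Finset.card_biUnion_le _)
  rw [Nat.card_Icc, Nat.add_sub_cancel] at hunion
  refine (Nat.cast_le (α := ℝ).2 hunion).trans ?_
  push_cast
  refine add_le_add (Nat.floor_le (by positivity)) ?_
  refine (Finset.sum_le_card_nsmul J _ _ fun j _ =>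
    card_abs_log_sub_lt_le (α * j + β) ε hε n).trans ?_
  rw [nsmul_eq_mul, ← hba]
  have he : 1 ≤ Real.exp (2 * ε) := Real.one_le_exp (by linarith)
  have : 0 ≤ (n : ℝ) * (Real.exp (2 * ε) - 1) := mul_nonneg hn0.le (by linarith)
  exact mul_le_mul_of_nonneg_right (Int.card_Icc_ceil_floor_le hab) (by linarith)

/-- The asymptotic upper density of the set of `k` whose logarithm lies within `ε` of the
arithmetic progression `αℤ + β` tends to `0` as `ε → 0`. -/
theorem log_near_arithmetic_progression_density (α β δ : ℝ) (hα : 0 < α) (hδ : 0 < δ) :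
    ∃ ε > (0 : ℝ),
      Filter.limsup (fun n : ℕ =>
        (Set.ncard {k : ℕ | k ∈ Finset.Icc 1 n ∧
          ∃ j : ℤ, |Real.log k - (α * j + β)| < ε} : ℝ) / n) atTop < δ := by
  set η := min (δ / 4) 1 with hη
  have hη0 : 0 < η := lt_min (by linarith) one_pos
  obtain ⟨ε, hεδ, hε⟩ : ∃ ε : ℝ,
      ((2 * ε - Real.log η) / α + 1) * (Real.exp (2 * ε) - 1) < δ / 4 ∧ 0 < ε := by
    have hcont : Continuous fun ε : ℝ =>
        ((2 * ε - Real.log η) / α + 1) * (Real.exp (2 * ε) - 1) := by fun_prop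
    have hlt := hcont.continuousAt.eventually_lt (x₀ := 0) (continuousAt_const (y := δ / 4))
      (by simpa using hδ)
    exact ((hlt.filter_mono nhdsWithin_le_nhds).and
      (self_mem_nhdsWithin : Set.Ioi (0 : ℝ) ∈ nhdsWithin 0 (Set.Ioi 0))).exists
  refine ⟨ε, hε, lt_of_le_of_lt (b := 3 * δ / 4) ?_ (by linarith)⟩
  refine limsup_le_of_le (isCoboundedUnder_le_of_le atTop (x := 0) fun n => by positivity) ?_
  set M := (2 * ε - Real.log η) / α + 1 with hM
  have hlim := (tendsto_const_div_atTop_nhds_zero_nat M).eventually_le_const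
    (show (0 : ℝ) < δ / 4 by linarith)
  filter_upwards [hlim, eventually_gt_atTop 0] with n hn hn0
  have hn0' : (0 : ℝ) < n := by exact_mod_cast hn0
  rw [div_le_iff₀ hn0'] at hn ⊢
  refine (ncard_log_near_arithmetic_progression_le α β η ε hα hη0 (min_le_right _ _) hε n
    hn0).trans ?_
  have h1 := mul_le_mul_of_nonneg_right (min_le_left (δ / 4) 1) hn0'.le
  have h2 := mul_le_mul_of_nonneg_right hεδ.le hn0'.le
  rw [← hM]
  linarith
end

section
/- Let n, k ∈ ℕ with 2 ≤ k ≤ n − 1, and let p be a prime number satisfying (n−1)/k < p < (n−1)/(k−1). Then p does not divide the Stirling number of the first kind ⟦n,k⟧, while p divides ⟦n,k−1⟧. -/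
open Real

/-- The (unsigned) Stirling number of the first kind `⟦n,k⟧`. -/
noncomputable def stirlingFirst (n k : ℕ) : ℕ := (ascPochhammer ℕ n).coeff k

open Polynomial in
/-- Modulo a prime `p`, exactly `m / p + 1` of the factors of `X (X + 1) ⋯ (X + m)` reduce to `X`. -/
theorem exists_ascPochhammer_zmod_eq_X_pow_mul (p : ℕ) [Fact p.Prime] (m : ℕ) :
    ∃ Q : (ZMod p)[X], ascPochhammer (ZMod p) (m + 1) = X ^ (m / p + 1) * Q ∧ Q.coeff 0 ≠ 0 := by
  induction m with
  | zero => exact ⟨1, by simp, by simp⟩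
  | succ m ih =>
    obtain ⟨Q, hQ, hQ0⟩ := ih
    rw [ascPochhammer_succ_right, hQ, Nat.succ_div]
    have hcast := ZMod.natCast_eq_zero_iff (m + 1) p
    split_ifs with h
    · refine ⟨Q, ?_, hQ0⟩
      have hzero : ((m + 1 : ℕ) : (ZMod p)[X]) = 0 := by
        rw [← C_eq_natCast, hcast.mpr h, C_0]
      rw [hzero]
      ring
    · refine ⟨Q * (X + ((m + 1 : ℕ) : (ZMod p)[X])), by ring, ?_⟩
      rw [mul_coeff_zero, coeff_add, coeff_X_zero, zero_add, ← C_eq_natCast, coeff_C_zero]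
      exact mul_ne_zero hQ0 (mt hcast.mp h)

theorem dvd_stirlingFirst_iff (p n k : ℕ) :
    p ∣ stirlingFirst n k ↔ (ascPochhammer (ZMod p) n).coeff k = 0 := by
  rw [← ZMod.natCast_eq_zero_iff, stirlingFirst, ← ascPochhammer_map (Nat.castRingHom (ZMod p)),
    Polynomial.coeff_map, eq_natCast]

/-- If `p` is a prime with `(n−1)/k < p < (n−1)/(k−1)`, then `p` does not divide `⟦n,k⟧`
but divides `⟦n,k−1⟧`. -/
theorem stirling_prime_divisibility (n k p : ℕ) (hk : 2 ≤ k) (hkn : k ≤ n - 1)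
    (hp : p.Prime) (h₁ : ((n : ℝ) - 1) / k < p) (h₂ : (p : ℝ) < ((n : ℝ) - 1) / (k - 1)) :
    ¬ p ∣ stirlingFirst n k ∧ p ∣ stirlingFirst n (k - 1) := by
  have : Fact p.Prime := ⟨hp⟩
  obtain ⟨m, rfl⟩ : ∃ m, n = m + 1 := ⟨n - 1, by omega⟩
  obtain ⟨j, rfl⟩ : ∃ j, k = j + 1 := ⟨k - 1, by omega⟩
  have hj : (0 : ℝ) < j := by exact_mod_cast (by omega : 0 < j)
  push_cast at h₁ h₂
  rw [add_sub_cancel_right, div_lt_iff₀ (by positivity)] at h₁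
  rw [add_sub_cancel_right, add_sub_cancel_right, lt_div_iff₀ hj] at h₂
  have hdiv : m / p = j := by
    apply Nat.div_eq_of_lt_le
    · rw [mul_comm]
      exact_mod_cast h₂.le
    · rw [mul_comm]
      exact_mod_cast h₁
  obtain ⟨Q, hQ, hQ0⟩ := exists_ascPochhammer_zmod_eq_X_pow_mul p m
  rw [hdiv] at hQ
  rw [dvd_stirlingFirst_iff, dvd_stirlingFirst_iff, hQ, Polynomial.coeff_X_pow_mul',
    Polynomial.coeff_X_pow_mul']
  simpa using hQ0
end

section
/- For every θ > 0: 2·(log ∘ Γ)″(θ) + θ·(log ∘ Γ)‴(θ) = 2·Σ_{k=1}^∞ k/(θ+k)³, and in particular this quantity is strictly positive. Here (log ∘ Γ)″ and (log ∘ Γ)‴ denote the second and third derivatives (iteratedDeriv 2 and iteratedDeriv 3) of the function x ↦ log Γ(x) at θ, with Γ the real Gamma function. -/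
open Real

open Filter Topology Set

lemma summable_one_div_add_nat_pow {a : ℝ} (ha : 0 < a) {k : ℕ} (hk : 2 ≤ k) :
    Summable fun n : ℕ => 1 / (a + n) ^ k := by
  have h := (Real.summable_one_div_nat_add_rpow a k).2 (by exact_mod_cast hk)
  refine h.congr fun n => ?_
  have hn : (0 : ℝ) < n + a := by positivity
  rw [abs_of_pos hn, Real.rpow_natCast, add_comm]

/-- The increment `logGammaSeq x (n + 2) - logGammaSeq x (n + 1)`. -/
noncomputable def logGammaSeqIncrement (n : ℕ) (x : ℝ) : ℝ :=
  x * (log (n + 2) - log (n + 1)) + log (n + 2) - log (x + (n + 2))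

lemma logGammaSeq_succ_eq_sum (x : ℝ) (n : ℕ) :
    BohrMollerup.logGammaSeq x (n + 1) =
      -log x - log (x + 1) + ∑ i ∈ Finset.range n, logGammaSeqIncrement i x := by
  induction n with
  | zero => simp [BohrMollerup.logGammaSeq, Finset.sum_range_succ]; ring
  | succ n ih =>
    rw [Finset.sum_range_succ, ← add_assoc, ← ih]
    simp only [BohrMollerup.logGammaSeq, logGammaSeqIncrement]
    rw [Finset.sum_range_succ _ (n + 1 + 1), Nat.factorial_succ (n + 1), Nat.cast_mul,
      Real.log_mul (by positivity) (by positivity)]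
    have h : (n : ℝ) + 1 + 1 = n + 2 := by ring
    push_cast
    rw [h]
    ring

lemma hasDerivAt_logGammaSeqIncrement {x : ℝ} (hx : -1 < x) (n : ℕ) :
    HasDerivAt (logGammaSeqIncrement n)
      (log (n + 2) - log (n + 1) - 1 / (x + (n + 2))) x := by
  have hn : (0 : ℝ) ≤ n := n.cast_nonneg
  have h1 := ((hasDerivAt_id x).add_const ((n : ℝ) + 2)).log (by simp; linarith)
  have h2 := ((hasDerivAt_id x).mul_const (log ((n : ℝ) + 2) - log (n + 1))).add_const
    (log ((n : ℝ) + 2))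
  simpa [logGammaSeqIncrement] using! h2.sub h1

lemma abs_deriv_logGammaSeqIncrement_le {b x : ℝ} (hx : -1 < x) (hxb : x < b) (n : ℕ) :
    ‖log (n + 2) - log (n + 1) - 1 / (x + (n + 2))‖ ≤ (b + 2) * (1 / (1 + n) ^ 2) := by
  have hn : (0 : ℝ) ≤ n := n.cast_nonneg
  have hb : 0 ≤ b + 1 := by linarith
  have hu : log ((n : ℝ) + 2) - log (n + 1) ≤ 1 / (n + 1) := by
    rw [← Real.log_div (by positivity) (by positivity)]
    refine (Real.log_le_sub_one_of_pos (by positivity)).trans (le_of_eq ?_)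
    field_simp
    ring
  have hl : 1 / ((n : ℝ) + 2) ≤ log (n + 2) - log (n + 1) := by
    rw [← Real.log_div (by positivity) (by positivity)]
    refine le_trans (le_of_eq ?_) (Real.one_sub_inv_le_log_of_pos (by positivity))
    field_simp
    ring
  have h1 : 1 / (x + (n + 2)) ≤ 1 / ((n : ℝ) + 1) :=
    one_div_le_one_div_of_le (by positivity) (by linarith)
  have h2 : 1 / (b + (n + 2)) ≤ 1 / (x + ((n : ℝ) + 2)) :=
    one_div_le_one_div_of_le (by linarith) (by linarith)
  have h3 : 1 / ((n : ℝ) + 1) - 1 / (b + (n + 2)) ≤ (b + 2) * (1 / (1 + n) ^ 2) := by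
    rw [div_sub_div _ _ (by positivity) (by linarith), mul_one_div,
      div_le_div_iff₀ (mul_pos (by positivity) (by linarith)) (by positivity)]
    nlinarith [mul_nonneg hb hb, mul_nonneg (mul_nonneg hn hn) hb, mul_nonneg hn hb,
      mul_nonneg (mul_nonneg hn hb) hb]
  have h4 : 1 / ((n : ℝ) + 1) - 1 / (n + 2) ≤ (b + 2) * (1 / (1 + n) ^ 2) := by
    rw [div_sub_div _ _ (by positivity) (by linarith), mul_one_div,
      div_le_div_iff₀ (mul_pos (by positivity) (by linarith)) (by positivity)]
    nlinarith [mul_nonneg (mul_nonneg hn hn) hb, mul_nonneg hn hb]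
  rw [Real.norm_eq_abs, abs_le]
  constructor <;> linarith

lemma summable_mul_one_div_one_add_nat_sq (c : ℝ) :
    Summable fun n : ℕ => c * (1 / (1 + (n : ℝ)) ^ 2) :=
  (summable_one_div_add_nat_pow one_pos le_rfl).mul_left c

lemma hasDerivAt_tsum_logGammaSeqIncrement {x : ℝ} (hx : -1 < x) :
    HasDerivAt (fun y => ∑' n, logGammaSeqIncrement n y)
      (∑' n : ℕ, (log (n + 2) - log (n + 1) - 1 / (x + (n + 2)))) x := by
  refine hasDerivAt_tsum_of_isPreconnected
    (summable_mul_one_div_one_add_nat_sq (|x| + 1 + 2)) (isOpen_Ioo (a := -1) (b := |x| + 1))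
    isPreconnected_Ioo (fun n y hy => hasDerivAt_logGammaSeqIncrement hy.1 n)
    (fun n y hy => abs_deriv_logGammaSeqIncrement_le hy.1 hy.2 n)
    (y₀ := 0) ⟨by norm_num, by positivity⟩ ?_ ⟨hx, by linarith [le_abs_self x]⟩
  simp [logGammaSeqIncrement, summable_zero]

lemma summable_logGammaSeqIncrement {x : ℝ} (hx : -1 < x) :
    Summable fun n => logGammaSeqIncrement n x := by
  refine summable_of_summable_hasDerivAt_of_isPreconnected
    (summable_mul_one_div_one_add_nat_sq (|x| + 1 + 2)) (isOpen_Ioo (a := -1) (b := |x| + 1))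
    isPreconnected_Ioo (fun n y hy => hasDerivAt_logGammaSeqIncrement hy.1 n)
    (fun n y hy => abs_deriv_logGammaSeqIncrement_le hy.1 hy.2 n)
    (y₀ := 0) ⟨by norm_num, by positivity⟩ ?_ ⟨hx, by linarith [le_abs_self x]⟩
  simp [logGammaSeqIncrement, summable_zero]

lemma log_Gamma_eq_tsum {x : ℝ} (hx : 0 < x) :
    log (Gamma x) = -log x - log (x + 1) + ∑' n, logGammaSeqIncrement n x := by
  refine tendsto_nhds_unique
    ((BohrMollerup.tendsto_log_gamma hx).comp (tendsto_add_atTop_nat 1)) ?_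
  refine ((summable_logGammaSeqIncrement (by linarith)).hasSum.tendsto_sum_nat.const_add
    (-log x - log (x + 1))).congr fun n => ?_
  exact (logGammaSeq_succ_eq_sum x n).symm

lemma deriv_log_Gamma_eq_tsum {x : ℝ} (hx : 0 < x) :
    deriv (fun y => log (Gamma y)) x = -(1 / x) - 1 / (x + 1) +
      ∑' n : ℕ, (log (n + 2) - log (n + 1) - 1 / (x + (n + 2))) := by
  have heq : (fun y => log (Gamma y)) =ᶠ[𝓝 x]
      fun y => -log y - log (y + 1) + ∑' n, logGammaSeqIncrement n y := by
    filter_upwards [Ioi_mem_nhds hx] with y hy using log_Gamma_eq_tsum hy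
  rw [heq.deriv_eq]
  have h1 := ((hasDerivAt_id x).add_const (1 : ℝ)).log (by simp; linarith)
  have h0 := (hasDerivAt_id x).log hx.ne'
  exact ((h0.neg.sub h1).add (hasDerivAt_tsum_logGammaSeqIncrement (by linarith))).deriv

lemma hasDerivAt_one_div_add_pow {x a : ℝ} (h : 0 < x + a) (k : ℕ) :
    HasDerivAt (fun y => 1 / (y + a) ^ k) (-(k * (1 / (x + a) ^ (k + 1)))) x := by
  have h1 := (((hasDerivAt_id x).add_const a).pow k).inv (pow_pos h k).ne'
  simp only [one_div]
  refine h1.congr_deriv ?_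
  rcases k with _ | k
  · simp
  · simp only [id, Pi.pow_apply, Nat.add_sub_cancel]
    field_simp
    ring

lemma hasDerivAt_tsum_one_div_add_nat_pow {x : ℝ} (hx : 0 < x) {k : ℕ} (hk : 2 ≤ k) :
    HasDerivAt (fun y : ℝ => ∑' n : ℕ, 1 / (y + n) ^ k)
      (-(k * ∑' n : ℕ, 1 / (x + n) ^ (k + 1))) x := by
  rw [← tsum_mul_left, ← tsum_neg]
  have hx2 : x ∈ Ioi (x / 2) := half_lt_self hx
  refine hasDerivAt_tsum_of_isPreconnected (g := fun (n : ℕ) (y : ℝ) => 1 / (y + n) ^ k)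
    (g' := fun (n : ℕ) (y : ℝ) => -(k * (1 / (y + n) ^ (k + 1))))
    ((summable_one_div_add_nat_pow (half_pos hx) (by lia : 2 ≤ k + 1)).mul_left (k : ℝ))
    (isOpen_Ioi (a := x / 2)) isPreconnected_Ioi (fun n y hy => ?_) (fun n y hy => ?_)
    hx2 (summable_one_div_add_nat_pow hx hk) hx2
  · have hy' : 0 < y := (half_pos hx).trans hy
    exact hasDerivAt_one_div_add_pow (by positivity) k
  · have hy' : 0 < y := (half_pos hx).trans hy
    rw [norm_neg, Real.norm_of_nonneg (by positivity)]
    have : x / 2 ≤ y := le_of_lt hy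
    gcongr

lemma iteratedDeriv_two_log_Gamma {x : ℝ} (hx : 0 < x) :
    iteratedDeriv 2 (fun y => log (Gamma y)) x = ∑' n : ℕ, 1 / (x + n) ^ 2 := by
  have heq : deriv (fun y => log (Gamma y)) =ᶠ[𝓝 x] fun y => -(1 / y) - 1 / (y + 1) +
      ∑' n : ℕ, (log (n + 2) - log (n + 1) - 1 / (y + (n + 2))) := by
    filter_upwards [Ioi_mem_nhds hx] with y hy using deriv_log_Gamma_eq_tsum hy
  rw [iteratedDeriv_succ, iteratedDeriv_one, heq.deriv_eq,
    ← (summable_one_div_add_nat_pow hx le_rfl).sum_add_tsum_nat_add 2]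
  have h0 : HasDerivAt (fun y : ℝ => 1 / y) (-(1 / x ^ 2)) x := by
    simpa using hasDerivAt_one_div_add_pow (x := x) (a := 0) (by simpa) 1
  have h1 : HasDerivAt (fun y : ℝ => 1 / (y + 1)) (-(1 / (x + 1) ^ 2)) x := by
    simpa using hasDerivAt_one_div_add_pow (x := x) (a := 1) (by linarith) 1
  have hS : HasDerivAt
      (fun y : ℝ => ∑' n : ℕ, (log (n + 2) - log (n + 1) - 1 / (y + (n + 2))))
      (∑' n : ℕ, 1 / (x + (n + 2)) ^ 2) x := by
    have hx0 : x ∈ Ioi 0 := hx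
    refine hasDerivAt_tsum_of_isPreconnected
      (g := fun (n : ℕ) (y : ℝ) => log (n + 2) - log (n + 1) - 1 / (y + (n + 2)))
      (g' := fun (n : ℕ) (y : ℝ) => 1 / (y + (n + 2)) ^ 2)
      (summable_one_div_add_nat_pow one_pos le_rfl) (isOpen_Ioi (a := 0)) isPreconnected_Ioi
      (fun n y hy => ?_) (fun n y hy => ?_) hx0 (.of_norm_bounded
        (summable_mul_one_div_one_add_nat_sq (x + 1 + 2)) fun n =>
          abs_deriv_logGammaSeqIncrement_le (by linarith) (by linarith) n) hx0
    · have hy' : 0 < y := hy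
      simpa using (hasDerivAt_one_div_add_pow (x := y) (a := n + 2) (by positivity) 1).const_sub
        (log ((n : ℝ) + 2) - log (n + 1))
    · have hy' : 0 < y := hy
      rw [Real.norm_of_nonneg (by positivity)]
      exact one_div_le_one_div_of_le (by positivity)
        (pow_le_pow_left₀ (by positivity) (by linarith) 2)
  refine ((h0.neg.sub h1).add hS).deriv.trans ?_
  simp [Finset.sum_range_succ]

lemma iteratedDeriv_three_log_Gamma {x : ℝ} (hx : 0 < x) :
    iteratedDeriv 3 (fun y => log (Gamma y)) x = -(2 * ∑' n : ℕ, 1 / (x + n) ^ 3) := by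
  have heq : iteratedDeriv 2 (fun y => log (Gamma y)) =ᶠ[𝓝 x]
      fun y => ∑' n : ℕ, 1 / (y + n) ^ 2 := by
    filter_upwards [Ioi_mem_nhds hx] with y hy using iteratedDeriv_two_log_Gamma hy
  rw [iteratedDeriv_succ, heq.deriv_eq]
  exact_mod_cast (hasDerivAt_tsum_one_div_add_nat_pow hx le_rfl).deriv

/-- For every `θ > 0`, `2(log Γ)″(θ) + θ(log Γ)‴(θ) = 2 Σ_{k=1}^∞ k/(θ+k)³ > 0`. -/
theorem two_trigamma_add_theta_tetragamma (θ : ℝ) (hθ : 0 < θ) :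
    2 * iteratedDeriv 2 (fun x => Real.log (Real.Gamma x)) θ +
        θ * iteratedDeriv 3 (fun x => Real.log (Real.Gamma x)) θ =
      2 * ∑' k : ℕ, ((k : ℝ) + 1) / (θ + ((k : ℝ) + 1)) ^ 3 ∧
    0 < 2 * iteratedDeriv 2 (fun x => Real.log (Real.Gamma x)) θ +
        θ * iteratedDeriv 3 (fun x => Real.log (Real.Gamma x)) θ := by
  have h2 := summable_one_div_add_nat_pow hθ le_rfl
  have h3 := summable_one_div_add_nat_pow hθ (by norm_num : 2 ≤ 3)
  have hterm : ∀ n : ℕ, 1 / (θ + n) ^ 2 - θ * (1 / (θ + n) ^ 3) = n / (θ + n) ^ 3 := by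
    intro n
    have : 0 < θ + n := by positivity
    field_simp
    ring
  have hs : Summable fun n : ℕ => (n : ℝ) / (θ + n) ^ 3 :=
    (h2.sub (h3.mul_left θ)).congr hterm
  have hs' : Summable fun n : ℕ => ((n : ℝ) + 1) / (θ + ((n : ℝ) + 1)) ^ 3 := by
    simpa using (summable_nat_add_iff 1).2 hs
  have heq : 2 * iteratedDeriv 2 (fun x => Real.log (Real.Gamma x)) θ +
        θ * iteratedDeriv 3 (fun x => Real.log (Real.Gamma x)) θ =
      2 * ∑' k : ℕ, ((k : ℝ) + 1) / (θ + ((k : ℝ) + 1)) ^ 3 := by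
    have hsum : ∑' n : ℕ, 1 / (θ + n) ^ 2 - θ * ∑' n : ℕ, 1 / (θ + n) ^ 3 =
        ∑' k : ℕ, ((k : ℝ) + 1) / (θ + ((k : ℝ) + 1)) ^ 3 := by
      rw [← tsum_mul_left, ← h2.tsum_sub (h3.mul_left θ), tsum_congr hterm, hs.tsum_eq_zero_add]
      simp
    rw [iteratedDeriv_two_log_Gamma hθ, iteratedDeriv_three_log_Gamma hθ, ← hsum]
    ring
  refine ⟨heq, heq ▸ mul_pos two_pos (hs'.tsum_pos (fun n => by positivity) 0 ?_)⟩
  positivity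
end

section
/- For every θ > 0 and β ∈ ℝ, lim_{n→∞} n^{−θ(e^β − 1)} · (θe^β)^{(n)} / θ^{(n)} = Γ(θ)/Γ(θ e^β), where s^{(n)} = s(s+1)⋯(s+n−1) denotes the rising factorial (evaluation of ascPochhammer ℝ n at s) and Γ is the real Gamma function. Equivalently, the exponentially tilted and normalized generating function W_n(β) = n^{−θ(e^β−1)} Σ_{k=1}^n e^{βk} L_n(θ,k) converges to Γ(θ)/Γ(θe^β). -/
open Real Filter

theorem eval_ascPochhammer_eq_prod_range (n : ℕ) (s : ℝ) :
    (ascPochhammer ℝ n).eval s = ∏ j ∈ Finset.range n, (s + j) := by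
  induction n with
  | zero => simp
  | succ n ih => rw [ascPochhammer_succ_eval, ih, Finset.prod_range_succ]

theorem eval_ascPochhammer_div_eq_GammaSeq {s t : ℝ} (hs : 0 < s) (ht : 0 < t) {n : ℕ}
    (hn : n ≠ 0) :
    (n : ℝ) ^ (t - s) * (ascPochhammer ℝ n).eval s / (ascPochhammer ℝ n).eval t =
      GammaSeq t n / GammaSeq s n * ((t + n) / (s + n)) := by
  have hn' : (0 : ℝ) < n := by positivity
  have hPs := ascPochhammer_pos n s hs
  have hPt := ascPochhammer_pos n t ht
  have hfact : (0 : ℝ) < n.factorial := by positivity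
  have hpow : (0 : ℝ) < (n : ℝ) ^ s := by positivity
  have hsn : s + n ≠ 0 := by positivity
  have htn : t + n ≠ 0 := by positivity
  rw [GammaSeq, GammaSeq, Finset.prod_range_succ, Finset.prod_range_succ,
    ← eval_ascPochhammer_eq_prod_range, ← eval_ascPochhammer_eq_prod_range, rpow_sub hn']
  field_simp

theorem tendsto_add_natCast_div_add_natCast (s t : ℝ) :
    Tendsto (fun n : ℕ => (t + n) / (s + n)) atTop (nhds 1) := by
  have h : Tendsto (fun n : ℕ => t / (s + n) + n / (n + s)) atTop (nhds (0 + 1)) :=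
    (tendsto_const_nhds.div_atTop
      (tendsto_atTop_add_const_left _ _ tendsto_natCast_atTop_atTop)).add
      (tendsto_natCast_div_add_atTop s)
  simpa only [add_comm _ s, ← add_div, zero_add] using h

/-- The ratio of rising factorials at `s` and `t` is asymptotic to `n ^ (s - t) * Γ t / Γ s`. -/
theorem tendsto_rpow_mul_eval_ascPochhammer_div {s t : ℝ} (hs : 0 < s) (ht : 0 < t) :
    Tendsto (fun n : ℕ => (n : ℝ) ^ (t - s) * (ascPochhammer ℝ n).eval s /
      (ascPochhammer ℝ n).eval t) atTop (nhds (Gamma t / Gamma s)) := by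
  have h := ((GammaSeq_tendsto_Gamma t).div (GammaSeq_tendsto_Gamma s)
    (Gamma_pos_of_pos hs).ne').mul (tendsto_add_natCast_div_add_natCast s t)
  rw [mul_one] at h
  refine h.congr' ?_
  filter_upwards [eventually_ne_atTop 0] with n hn
  exact (eval_ascPochhammer_div_eq_GammaSeq hs ht hn).symm

/-- Convergence of the tilted normalized generating function of the Ewens distribution:
`n^{−θ(e^β−1)} (θe^β)^{(n)} / θ^{(n)} → Γ(θ)/Γ(θe^β)`. -/
theorem ewens_tilted_generating_function_limit (θ β : ℝ) (hθ : 0 < θ) :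
    Tendsto (fun n : ℕ =>
      (n : ℝ) ^ (-(θ * (Real.exp β - 1))) *
        (ascPochhammer ℝ n).eval (θ * Real.exp β) / (ascPochhammer ℝ n).eval θ)
      atTop (nhds (Real.Gamma θ / Real.Gamma (θ * Real.exp β))) := by
  have hexp : -(θ * (Real.exp β - 1)) = θ - θ * Real.exp β := by ring
  rw [hexp]
  exact tendsto_rpow_mul_eval_ascPochhammer_div (mul_pos hθ (Real.exp_pos β)) hθ
end
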